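/- arXiv:1202.1208 — 2 statements merged into one kernel-verified Lean document; each statement's English description precedes it below -/
import Mathlib

section
/- Suppose R : V ⇝ V is a linear relation on a finite-dimensional vector space. Then D₊ = D + K₊ and D₋ = K₋ + D, where D = D₋ ∩ D₊. -/
variable {A V : Type*} [CommRing A] [AddCommGroup V] [Module A V]

/-- `K₊`: elements admitting a finite forward `R`-chain ending at `0`:
`v R v₁ R v₂ R ⋯ R v_k R 0`. -/
def KplusSet (R : Submodule A (V × V)) : Set V :=
  {v | ∃ (n : ℕ) (c : ℕ → V), c 0 = v ∧ c (n + 1) = 0 ∧ ∀ i ≤ n, (c i, c (i + 1)) ∈ R}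

/-- `K₋`: elements reached from `0` by a finite forward `R`-chain:
`0 R v_{-k} R ⋯ R v_{-1} R v`. -/
def KminusSet (R : Submodule A (V × V)) : Set V :=
  {v | ∃ (n : ℕ) (c : ℕ → V), c 0 = 0 ∧ c (n + 1) = v ∧ ∀ i ≤ n, (c i, c (i + 1)) ∈ R}

/-- `D₊`: elements admitting an infinite forward `R`-chain `v R v₁ R v₂ R ⋯`. -/
def DplusSet (R : Submodule A (V × V)) : Set V :=
  {v | ∃ c : ℕ → V, c 0 = v ∧ ∀ i, (c i, c (i + 1)) ∈ R}

/-- `D₋`: elements admitting an infinite backward `R`-chain `⋯ R v₂ R v₁ R v`. -/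
def DminusSet (R : Submodule A (V × V)) : Set V :=
  {v | ∃ c : ℕ → V, c 0 = v ∧ ∀ i, (c (i + 1), c i) ∈ R}

/-- `D₊` as a submodule. -/
def dplus (R : Submodule A (V × V)) : Submodule A V where
  carrier := DplusSet R
  zero_mem' := ⟨fun _ => 0, rfl, fun _ => R.zero_mem⟩
  add_mem' := by
    rintro _ _ ⟨c, rfl, hc⟩ ⟨e, rfl, he⟩
    exact ⟨fun i => c i + e i, rfl, fun i => R.add_mem (hc i) (he i)⟩
  smul_mem' := by
    rintro a _ ⟨c, rfl, hc⟩
    exact ⟨fun i => a • c i, rfl, fun i => R.smul_mem a (hc i)⟩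

theorem KplusSet_subset_DplusSet (R : Submodule A (V × V)) : KplusSet R ⊆ DplusSet R := by
  rintro _ ⟨n, c, rfl, hn, hc⟩
  refine ⟨fun i => if i ≤ n then c i else 0, by simp, fun i => ?_⟩
  rcases lt_trichotomy i n with h | rfl | h
  · simpa [h.le, Nat.succ_le_of_lt h] using hc i h.le
  · simpa [hn] using hc i le_rfl
  · simp only [show ¬ i ≤ n by omega, show ¬ i + 1 ≤ n by omega, if_false]
    exact R.zero_mem

/-- Elements of `D₊` that end a backward `R`-chain of length `n` inside `D₊`. -/
def dplusImage (R : Submodule A (V × V)) : ℕ → Submodule A V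
  | 0 => dplus R
  | n + 1 => dplus R ⊓ (R ⊓ (dplusImage R n).comap (LinearMap.fst A V V)).map (LinearMap.snd A V V)

theorem mem_dplusImage_succ {R : Submodule A (V × V)} {n : ℕ} {y : V} :
    y ∈ dplusImage R (n + 1) ↔ y ∈ dplus R ∧ ∃ x ∈ dplusImage R n, (x, y) ∈ R := by
  simp [dplusImage, and_comm]

theorem dplusImage_le_dplus (R : Submodule A (V × V)) (n : ℕ) : dplusImage R n ≤ dplus R := by
  cases n with
  | zero => exact le_rfl
  | succ n => exact inf_le_left

theorem dplusImage_antitone (R : Submodule A (V × V)) : Antitone (dplusImage R) := by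
  refine antitone_nat_of_succ_le fun n => ?_
  induction n with
  | zero => exact dplusImage_le_dplus R 1
  | succ n ih =>
    intro y hy
    obtain ⟨hy, x, hx, hxy⟩ := mem_dplusImage_succ.1 hy
    exact mem_dplusImage_succ.2 ⟨hy, x, ih hx, hxy⟩

theorem exists_eq_add_of_mem_DplusSet [IsArtinian A V] (R : Submodule A (V × V)) {v : V}
    (hv : v ∈ DplusSet R) :
    ∃ d ∈ DminusSet R ∩ DplusSet R, ∃ k ∈ KplusSet R, v = d + k := by
  obtain ⟨c, rfl, hc⟩ := hv
  obtain ⟨N, hN⟩ := IsArtinian.monotone_stabilizes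
    (⟨fun n => OrderDual.toDual (dplusImage R n), fun _ _ h => dplusImage_antitone R h⟩ :
      ℕ →o (Submodule A V)ᵒᵈ)
  have hstab : dplusImage R N = dplusImage R (N + 1) := hN (N + 1) N.le_succ
  have hmem : ∀ i, c i ∈ dplusImage R i := by
    have hD : ∀ i, c i ∈ dplus R := fun i => ⟨fun j => c (i + j), rfl, fun j => hc (i + j)⟩
    intro i
    induction i with
    | zero => exact hD 0
    | succ i ih => exact mem_dplusImage_succ.2 ⟨hD _, c i, ih, hc i⟩
  have hpred : ∀ p : dplusImage R N, ∃ q : dplusImage R N, ((q : V), (p : V)) ∈ R := by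
    rintro ⟨p, hp⟩
    obtain ⟨-, q, hq, hqp⟩ := mem_dplusImage_succ.1 (hstab ▸ hp)
    exact ⟨⟨q, hq⟩, hqp⟩
  choose f hf using hpred
  let b : ℕ → dplusImage R N := fun n => f^[n] ⟨c (N + 1), hstab ▸ hmem (N + 1)⟩
  have hb : ∀ n, ((b (n + 1) : V), (b n : V)) ∈ R := fun n => by
    simp only [b, Function.iterate_succ_apply']
    exact hf _
  refine ⟨b (N + 1), ⟨⟨fun i => b (N + 1 + i), rfl, fun i => hb (N + 1 + i)⟩,
    dplusImage_le_dplus R N (b (N + 1)).2⟩, c 0 - b (N + 1),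
    ⟨N, fun i => c i - b (N + 1 - i), rfl, by simp [b], fun i hi => ?_⟩, by abel⟩
  have h := hb (N - i)
  rw [show N - i + 1 = N + 1 - i by omega] at h
  simpa [show N + 1 - (i + 1) = N - i by omega] using R.sub_mem (hc i) h

theorem DplusSet_eq_add [IsArtinian A V] (R : Submodule A (V × V)) :
    DplusSet R = {x | ∃ d ∈ DminusSet R ∩ DplusSet R, ∃ k ∈ KplusSet R, x = d + k} := by
  refine Set.Subset.antisymm (fun v hv => exists_eq_add_of_mem_DplusSet R hv) ?_
  rintro _ ⟨d, hd, k, hk, rfl⟩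
  exact (dplus R).add_mem hd.2 (KplusSet_subset_DplusSet R hk)

/-- The converse relation. -/
def converse (R : Submodule A (V × V)) : Submodule A (V × V) :=
  R.comap (LinearEquiv.prodComm A V V).toLinearMap

theorem KplusSet_converse (R : Submodule A (V × V)) : KplusSet (converse R) = KminusSet R := by
  ext v
  constructor
  all_goals
    rintro ⟨n, c, h0, hn, hc⟩
    refine ⟨n, fun i => c (n + 1 - i), by simpa, by simpa, fun i hi => ?_⟩
    have h := hc (n - i) (Nat.sub_le n i)
    rw [show n - i + 1 = n + 1 - i by omega] at h
    dsimp only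
    rw [show n + 1 - (i + 1) = n - i by omega]
    exact h

/-- For a linear relation `R` on a finite-dimensional vector space,
`D₊ = D + K₊` and `D₋ = K₋ + D`, where `D = D₋ ∩ D₊`. -/
theorem stmt6 {κ V : Type*} [Field κ] [AddCommGroup V] [Module κ V] [FiniteDimensional κ V]
    (R : Submodule κ (V × V)) :
    DplusSet R = {x | ∃ d ∈ DminusSet R ∩ DplusSet R, ∃ k ∈ KplusSet R, x = d + k}
    ∧ DminusSet R = {x | ∃ k ∈ KminusSet R, ∃ d ∈ DminusSet R ∩ DplusSet R, x = k + d} := by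
  refine ⟨DplusSet_eq_add R, ?_⟩
  have h : DminusSet R = {x | ∃ d ∈ DplusSet R ∩ DminusSet R, ∃ k ∈ KplusSet (converse R),
      x = d + k} := DplusSet_eq_add (converse R)
  rw [KplusSet_converse] at h
  refine h.trans (Set.ext fun x => ⟨?_, ?_⟩)
  · rintro ⟨d, hd, k, hk, rfl⟩
    exact ⟨k, hk, d, hd.symm, add_comm d k⟩
  · rintro ⟨k, hk, d, hd, rfl⟩
    exact ⟨d, hd.symm, k, hk, add_comm k d⟩
end

section
/- Suppose R : V ⇝ V is a linear relation on a finite-dimensional vector space. Then K₋ ∩ D₊ = K₋ ∩ K₊ = D₋ ∩ K₊. -/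
variable {A V : Type*} [CommRing A] [AddCommGroup V] [Module A V]

/-- A vector lies in `K₊` exactly when it starts an infinite chain that is eventually zero. -/
theorem mem_KplusSet_iff {R : Submodule A (V × V)} {v : V} :
    v ∈ KplusSet R ↔
      ∃ (n : ℕ) (c : ℕ → V), c 0 = v ∧ (∀ i, (c i, c (i + 1)) ∈ R) ∧ ∀ i, n ≤ i → c i = 0 := by
  constructor
  · rintro ⟨n, c, h0, hn, hc⟩
    refine ⟨n + 1, fun i ↦ if i ≤ n then c i else 0, by simpa using h0, fun i ↦ ?_, fun i hi ↦ ?_⟩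
    · rcases lt_trichotomy i n with h | rfl | h
      · simpa [h.le, Nat.succ_le_of_lt h] using hc i h.le
      · simpa [hn] using hc i le_rfl
      · simp [show ¬ i ≤ n by omega, show ¬ i + 1 ≤ n by omega, ← Prod.zero_eq_mk]
    · simp [show ¬ i ≤ n by omega]
  · rintro ⟨n, c, h0, hc, hn⟩
    exact ⟨n, c, h0, hn _ n.le_succ, fun i _ ↦ hc i⟩

/-- `K₊` as a submodule. -/
def Kplus (R : Submodule A (V × V)) : Submodule A V where
  carrier := KplusSet R
  zero_mem' := ⟨0, 0, rfl, rfl, fun _ _ ↦ R.zero_mem⟩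
  add_mem' := by
    intro v w hv hw
    obtain ⟨n, c, rfl, hc, hn⟩ := mem_KplusSet_iff.1 hv
    obtain ⟨m, d, rfl, hd, hm⟩ := mem_KplusSet_iff.1 hw
    refine mem_KplusSet_iff.2 ⟨max n m, c + d, rfl, fun i ↦ R.add_mem (hc i) (hd i), fun i hi ↦ ?_⟩
    simp [hn i (le_of_max_le_left hi), hm i (le_of_max_le_right hi)]
  smul_mem' := by
    rintro a v ⟨n, c, rfl, hn, hc⟩
    exact ⟨n, a • c, rfl, by simp [hn], fun i hi ↦ R.smul_mem a (hc i hi)⟩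

theorem mem_Kplus_of_chain {R : Submodule A (V × V)} {k : ℕ} {c : ℕ → V} (hk : c k = 0)
    (hc : ∀ i, (c i, c (i + 1)) ∈ R) : c 0 ∈ Kplus R := by
  cases k with
  | zero => simp [hk]
  | succ k => exact ⟨k, c, rfl, hk, fun i _ ↦ hc i⟩

/-- A combination of the first `q` terms of a chain issuing from `0` is the `q`-th term of a
combination of delayed copies of that chain. -/
theorem exists_chain_of_mem_span {R : Submodule A (V × V)} {c : ℕ → V} (h0 : c 0 = 0)
    (hc : ∀ i, (c i, c (i + 1)) ∈ R) (q : ℕ) {y : V}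
    (hy : y ∈ Submodule.span A (c '' Set.Iio q)) :
    ∃ d : ℕ → V, (∀ i, (d i, d (i + 1)) ∈ R) ∧ d q = y ∧
      ∀ m, d m ∈ Submodule.span A (c '' Set.Iio m) := by
  induction hy using Submodule.span_induction with
  | mem x hx =>
    obtain ⟨i, hi, rfl⟩ := hx
    have hi : i < q := hi
    refine ⟨fun m ↦ c (m - (q - i)), fun m ↦ ?_, ?_, fun m ↦ ?_⟩
    · rcases le_or_gt (q - i) m with h | h
      · simpa only [Nat.sub_add_comm h] using hc (m - (q - i))
      · simp [show m - (q - i) = 0 by omega, show m + 1 - (q - i) = 0 by omega, h0,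
          ← Prod.zero_eq_mk]
    · simp only [show q - (q - i) = i by omega]
    · rcases m.eq_zero_or_pos with rfl | hm
      · simp [h0]
      · exact Submodule.subset_span ⟨_, show m - (q - i) < m by omega, rfl⟩
  | zero => exact ⟨0, fun _ ↦ R.zero_mem, rfl, fun _ ↦ Submodule.zero_mem _⟩
  | add x y _ _ hx hy =>
    obtain ⟨d, hd, rfl, hd'⟩ := hx
    obtain ⟨e, he, rfl, he'⟩ := hy
    exact ⟨d + e, fun i ↦ R.add_mem (hd i) (he i), rfl,
      fun m ↦ Submodule.add_mem _ (hd' m) (he' m)⟩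
  | smul a x _ hx =>
    obtain ⟨d, hd, rfl, hd'⟩ := hx
    exact ⟨a • d, fun i ↦ R.smul_mem a (hd i), rfl, fun m ↦ Submodule.smul_mem _ a (hd' m)⟩

theorem exists_ge_mem_span_image_Iio [IsNoetherian A V] (c : ℕ → V) (n : ℕ) :
    ∃ q, n ≤ q ∧ c q ∈ Submodule.span A (c '' Set.Iio q) := by
  obtain ⟨N, hN⟩ := monotone_stabilizes_iff_noetherian.2 ‹IsNoetherian A V›
    ⟨fun q ↦ Submodule.span A (c '' Set.Iio q),
      fun _ _ h ↦ Submodule.span_mono (Set.image_mono (Set.Iio_subset_Iio h))⟩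
  refine ⟨max N n, le_max_right _ _, ?_⟩
  have h : Submodule.span A (c '' Set.Iio (max N n)) =
      Submodule.span A (c '' Set.Iio (max N n + 1)) :=
    (hN (max N n) (le_max_left _ _)).symm.trans (hN (max N n + 1) (by omega))
  rw [h]
  exact Submodule.subset_span ⟨_, Nat.lt_succ_self _, rfl⟩

/-- In a Noetherian module, every term of an infinite chain issuing from `0` lies in `K₊`. -/
theorem chain_mem_Kplus [IsNoetherian A V] {R : Submodule A (V × V)} {c : ℕ → V} (h0 : c 0 = 0)
    (hc : ∀ i, (c i, c (i + 1)) ∈ R) (n : ℕ) : c n ∈ Kplus R := by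
  induction n using Nat.strong_induction_on with
  | _ n ih =>
    obtain ⟨q, hnq, hq⟩ := exists_ge_mem_span_image_Iio (A := A) c n
    obtain ⟨d, hd, hdq, hd'⟩ := exists_chain_of_mem_span h0 hc q hq
    have hsub : c n - d n ∈ Kplus R := by
      refine mem_Kplus_of_chain (k := q - n) (c := fun i ↦ c (n + i) - d (n + i)) ?_
        fun i ↦ R.sub_mem (hc (n + i)) (hd (n + i))
      simp [Nat.add_sub_cancel' hnq, hdq]
    have hdn : d n ∈ Kplus R := by
      refine Submodule.span_le.2 ?_ (hd' n)
      rintro _ ⟨i, hi, rfl⟩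
      exact ih i hi
    simpa using (Kplus R).add_mem hsub hdn

theorem KminusSet_inter_DplusSet_subset_KplusSet [IsNoetherian A V] (R : Submodule A (V × V)) :
    KminusSet R ∩ DplusSet R ⊆ KplusSet R := by
  rintro v ⟨⟨n, e, h0, rfl, he⟩, d, hd0, hd⟩
  have hmem := chain_mem_Kplus (R := R) (c := fun i ↦ if i ≤ n then e i else d (i - (n + 1)))
    (by simpa using h0) (fun i ↦ ?_) (n + 1)
  · change e (n + 1) ∈ Kplus R
    simpa [hd0] using hmem
  · rcases lt_trichotomy i n with h | rfl | h
    · simpa [h.le, Nat.succ_le_of_lt h] using he i h.le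
    · simpa [hd0] using he i le_rfl
    · simpa [show ¬ i ≤ n by omega, show ¬ i + 1 ≤ n by omega,
        show i + 1 - (n + 1) = i - (n + 1) + 1 by omega] using hd (i - (n + 1))

/-- The converse relation. -/
def converseRel (R : Submodule A (V × V)) : Submodule A (V × V) :=
  R.comap (LinearEquiv.prodComm A V V).toLinearMap

theorem KplusSet_converseRel (R : Submodule A (V × V)) :
    KplusSet (converseRel R) = KminusSet R := by
  ext v
  constructor
  all_goals
    rintro ⟨n, c, h0, hn, hc⟩
    refine ⟨n, fun i ↦ c (n + 1 - i), by simpa using hn, by simpa using h0, fun i hi ↦ ?_⟩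
    have h := hc (n - i) (Nat.sub_le n i)
    rw [show n - i + 1 = n + 1 - i by omega] at h
    simpa [converseRel] using h

theorem KminusSet_converseRel (R : Submodule A (V × V)) :
    KminusSet (converseRel R) = KplusSet R :=
  (KplusSet_converseRel (converseRel R)).symm

theorem DplusSet_converseRel (R : Submodule A (V × V)) :
    DplusSet (converseRel R) = DminusSet R := rfl

/-- For a linear relation `R` on a finite-dimensional vector space,
`K₋ ∩ D₊ = K₋ ∩ K₊ = D₋ ∩ K₊`. -/
theorem stmt7 {κ V : Type*} [Field κ] [AddCommGroup V] [Module κ V] [FiniteDimensional κ V]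
    (R : Submodule κ (V × V)) :
    KminusSet R ∩ DplusSet R = KminusSet R ∩ KplusSet R
    ∧ KminusSet R ∩ KplusSet R = DminusSet R ∩ KplusSet R := by
  constructor
  · exact Set.Subset.antisymm
      (fun _ h ↦ ⟨h.1, KminusSet_inter_DplusSet_subset_KplusSet R h⟩)
      (Set.inter_subset_inter_right _ (KplusSet_subset_DplusSet R))
  · have hK := KminusSet_inter_DplusSet_subset_KplusSet (converseRel R)
    have hD := KplusSet_subset_DplusSet (converseRel R)
    rw [KplusSet_converseRel, DplusSet_converseRel] at hK hD
    rw [KminusSet_converseRel] at hK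
    exact Set.Subset.antisymm (Set.inter_subset_inter_left _ hD)
      (fun _ h ↦ ⟨hK h.symm, h.2⟩)
end
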